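/- Let μ : (0,1] → (0,∞) be a nonincreasing function with ∫_0^1 μ(s) ds < ∞, and suppose that liminf_{t→0⁺} (log μ(t))/(log(1/t)) = 1. Define S(t) = ∫_0^t μ(s) ds for t ∈ (0,1]. Then liminf_{t→0⁺} S(2t)/S(t) = 1. -/

import Mathlib

open Filter MeasureTheory Set Topology

theorem liminf_order_one_of_integrable_implies_liminf_ratio_one
    (μ S : ℝ → ℝ)
    (hpos : ∀ t ∈ Set.Ioc (0:ℝ) 1, 0 < μ t)
    (hmono : ∀ s ∈ Set.Ioc (0:ℝ) 1, ∀ t ∈ Set.Ioc (0:ℝ) 1, s ≤ t → μ t ≤ μ s)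
    (hint : IntegrableOn μ (Set.Ioc (0:ℝ) 1) volume)
    (hord : Filter.liminf (fun t => Real.log (μ t) / Real.log (1 / t)) (𝓝[>] (0:ℝ)) = 1)
    (hS : ∀ t ∈ Set.Ioc (0:ℝ) 1, S t = ∫ s in Set.Ioc 0 t, μ s) :
    Filter.liminf (fun t => S (2 * t) / S t) (𝓝[>] (0:ℝ)) = 1 := by
  have hsub : ∀ t ∈ Set.Ioc (0:ℝ) 1, Set.Ioc (0:ℝ) t ⊆ Set.Ioc (0:ℝ) 1 := fun t ht =>
    Set.Ioc_subset_Ioc_right ht.2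
  have hlow : ∀ t ∈ Set.Ioc (0:ℝ) 1, t * μ t ≤ S t := by
    intro t ht
    rw [hS t ht]
    have h1 : ∫ s in Set.Ioc 0 t, μ t = t * μ t := by
      simp [ht.1.le]
    rw [← h1]
    refine setIntegral_mono_on ?_ (hint.mono_set (hsub t ht)) measurableSet_Ioc ?_
    · exact integrableOn_const (by simp)
    · intro x hx
      exact hmono x (hsub t ht hx) t ht hx.2
  have hSpos : ∀ t ∈ Set.Ioc (0:ℝ) 1, 0 < S t := fun t ht =>
    lt_of_lt_of_le (mul_pos ht.1 (hpos t ht)) (hlow t ht)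
  have hSmono : ∀ t, 0 < t → 2 * t ≤ 1 → S t ≤ S (2 * t) := by
    intro t h0 h1
    have h2 : 2 * t ∈ Set.Ioc (0:ℝ) 1 := ⟨by linarith, h1⟩
    rw [hS t ⟨h0, by linarith⟩, hS _ h2]
    refine setIntegral_mono_set (hint.mono_set (hsub _ h2)) ?_ ?_
    · filter_upwards [ae_restrict_mem measurableSet_Ioc] with x hx
      exact (hpos x (hsub _ h2 hx)).le
    · exact (Set.Ioc_subset_Ioc_right (by linarith)).eventuallyLE
  have hev : ∀ r < (1:ℝ), ∀ᶠ t in 𝓝[>] (0:ℝ), r ≤ Real.log (μ t) / Real.log (1 / t) := by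
    intro r hr
    rw [Filter.liminf_eq] at hord
    have hne : {a : ℝ | ∀ᶠ t in 𝓝[>] (0:ℝ), a ≤ Real.log (μ t) / Real.log (1 / t)}.Nonempty := by
      by_contra h
      rw [Set.not_nonempty_iff_eq_empty] at h
      rw [h, Real.sSup_empty] at hord
      exact zero_ne_one hord
    obtain ⟨a, ha, hra⟩ := exists_lt_of_lt_csSup hne (by rw [hord]; exact hr)
    filter_upwards [ha] with t ht
    exact hra.le.trans ht
  have hIoo : ∀ᶠ t in 𝓝[>] (0:ℝ), t ∈ Set.Ioo (0:ℝ) (1/2) :=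
    Ioo_mem_nhdsGT (by norm_num)
  rw [Filter.liminf_eq]
  refine IsGreatest.csSup_eq ⟨?_, ?_⟩
  · filter_upwards [hIoo] with t ht
    rw [one_le_div (hSpos t ⟨ht.1, by linarith [ht.2]⟩)]
    exact hSmono t ht.1 (by linarith [ht.2])
  · intro c hc
    by_contra! h1
    have hc0 : 0 < c := by linarith
    have hL : 0 < Real.log c := Real.log_pos h1
    have h2 : 0 < Real.log 2 := Real.log_pos (by norm_num)
    obtain ⟨r, hr⟩ : ∃ r, r = 1 - Real.log c / (2 * Real.log 2) := ⟨_, rfl⟩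
    have hr1 : r < 1 := by
      rw [hr]; have : 0 < Real.log c / (2 * Real.log 2) := by positivity
      linarith
    have hr2 : (1 - r) * Real.log 2 = Real.log c / 2 := by
      rw [hr]; field_simp; ring
    have hall := (hIoo.and ((hev r hr1).and hc))
    rw [eventually_nhdsWithin_iff, Metric.eventually_nhds_iff] at hall
    obtain ⟨δ, hδ, hall⟩ := hall
    have hA : ∀ t, 0 < t → t < δ → t < 1/2 ∧ r ≤ Real.log (μ t) / Real.log (1 / t) ∧
        c ≤ S (2 * t) / S t := by
      intro t h0 hd
      have := hall (y := t) (by rw [Real.dist_eq, sub_zero, abs_of_pos h0]; exact hd) h0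
      exact ⟨this.1.2, this.2.1, this.2.2⟩
    obtain ⟨t0, ht0⟩ : ∃ t0, t0 = δ / 2 := ⟨_, rfl⟩
    have h0 : 0 < t0 := by rw [ht0]; linarith
    have htn : ∀ n : ℕ, 0 < t0 / 2 ^ n ∧ t0 / 2 ^ n < δ := by
      intro n
      refine ⟨by positivity, ?_⟩
      have : t0 / 2 ^ n ≤ t0 := div_le_self h0.le (one_le_pow₀ (by norm_num))
      linarith
    have hdec : ∀ n : ℕ, S (t0 / 2 ^ n) * c ^ n ≤ S t0 := by
      intro n
      induction n with
      | zero => simp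
      | succ n ih =>
        obtain ⟨p1, p2⟩ := htn (n + 1)
        obtain ⟨q1, -, q2⟩ := hA _ p1 p2
        have e : 2 * (t0 / 2 ^ (n + 1)) = t0 / 2 ^ n := by rw [pow_succ]; field_simp
        rw [le_div_iff₀ (hSpos _ ⟨p1, by linarith⟩), e] at q2
        calc S (t0 / 2 ^ (n + 1)) * c ^ (n + 1) = (c * S (t0 / 2 ^ (n + 1))) * c ^ n := by ring
          _ ≤ S (t0 / 2 ^ n) * c ^ n := by gcongr
          _ ≤ _ := ih
    have hK : ∀ n : ℕ, n * (Real.log c / 2) ≤ Real.log (S t0) - (1 - r) * Real.log t0 := by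
      intro n
      obtain ⟨p1, p2⟩ := htn n
      obtain ⟨q1, q2, -⟩ := hA _ p1 p2
      have hm : t0 / 2 ^ n ∈ Set.Ioc (0:ℝ) 1 := ⟨p1, by linarith⟩
      have hlt : Real.log (t0 / 2 ^ n) < 0 := Real.log_neg p1 (by linarith)
      rw [one_div, Real.log_inv, le_div_iff₀ (by linarith)] at q2
      have hmul : (t0 / 2 ^ n * μ (t0 / 2 ^ n)) * c ^ n ≤ S t0 :=
        le_trans (mul_le_mul_of_nonneg_right (hlow _ hm) (by positivity)) (hdec n)
      have hμ := hpos _ hm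
      have hlog := Real.log_le_log (by positivity) hmul
      rw [Real.log_mul (by positivity) (by positivity), Real.log_mul p1.ne' hμ.ne',
        Real.log_pow] at hlog
      have he : Real.log (t0 / 2 ^ n) = Real.log t0 - n * Real.log 2 := by
        rw [Real.log_div h0.ne' (by positivity), Real.log_pow]
      rw [he] at hlog q2
      have hr3 : (n:ℝ) * ((1 - r) * Real.log 2) = n * (Real.log c / 2) := by rw [hr2]
      linarith
    obtain ⟨n, hn⟩ := exists_nat_gt ((Real.log (S t0) - (1 - r) * Real.log t0) / (Real.log c / 2))
    rw [div_lt_iff₀ (by positivity)] at hn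
    exact absurd (hK n) (not_le.mpr hn)
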